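/- (Proposition 2.) In the hierarchical game with pricing agreements, with N ≥ 3 subscribers and N content providers, demand φ > 0, congestion parameter a > 0 and price cap p_max > aφ(N+1)/(3N−1), the triple (ȳ, z̄, q̄) with q̄ = aφ(N+1)/(3N−1), z̄ = (φ/N)·(2N−2)/(3N−1), ȳ = (φ/N)·(1 + (N−1)(N+1)/(3N−1)) is a symmetric equilibrium: (i) when every CP charges q̄ to its non-associated subscribers, the profile in which each subscriber n sends ȳ to its associated CP n and z̄ to each other CP is a Nash equilibrium of the agreement congestion game; and (ii) for every deviation price p ∈ [0, p_max] of a single CP, its revenue satisfies p·(N−1)·u(p, q̄) ≤ q̄·(N−1)·z̄, where u(p, q) = (φ − q/a)/N − 2(N−1)(p − q)/(a·N·(N+1)) is the follower-equilibrium flow from each non-associated subscriber to the deviating CP. -/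

import Mathlib

open Finset

/-- A strategy of a subscriber is feasible if it is nonnegative and sums to the demand `φ`. -/
def Feasible (M : ℕ) (φ : ℝ) (v : Fin M → ℝ) : Prop :=
  (∀ m, 0 ≤ v m) ∧ ∑ m, v m = φ

/-- Cost of subscriber `n` in the agreement congestion game: subscriber `n` pays nothing
per unit of traffic downloaded from its associated CP `n`, and pays `p m` per unit of
traffic from every other CP `m`; the congestion cost is linear, `D(t) = a·t`. -/
noncomputable def costV (N : ℕ) (a : ℝ) (p : Fin N → ℝ)
    (x : Fin N → Fin N → ℝ) (n : Fin N) : ℝ :=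
  ∑ m, x n m * (a * (∑ n', x n' m) + if m = n then 0 else p m)

/-- Nash equilibrium of the agreement congestion game. -/
def IsNashV (N : ℕ) (φ a : ℝ) (p : Fin N → ℝ) (x : Fin N → Fin N → ℝ) : Prop :=
  (∀ n, Feasible N φ (x n)) ∧
  ∀ (n : Fin N) (y : Fin N → ℝ), Feasible N φ y →
    costV N a p x n ≤ costV N a p (Function.update x n y) n

/-- Follower-equilibrium flow from each non-associated subscriber to a CP charging `p`
when all other CPs charge `q` in the agreement game. -/
noncomputable def uFlow (N : ℕ) (a φ p q : ℝ) : ℝ :=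
  (φ - q / a) / N - 2 * ((N : ℝ) - 1) * (p - q) / (a * (N : ℝ) * ((N : ℝ) + 1))

/-- If every column of `x` carries total traffic `φ` and the marginal costs of subscriber `n`
agree across providers, then `x n` is a best reply of subscriber `n`. -/
theorem costV_le_update_of_marginal_eq {N : ℕ} {φ a c : ℝ} (ha : 0 ≤ a) {p : Fin N → ℝ}
    {x : Fin N → Fin N → ℝ} {n : Fin N} (hload : ∀ m, ∑ n', x n' m = φ)
    (hmarg : ∀ m, (if m = n then 0 else p m) = a * (c - x n m))
    {y : Fin N → ℝ} (hsum : ∑ m, y m = ∑ m, x n m) :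
    costV N a p x n ≤ costV N a p (Function.update x n y) n := by
  have hload' : ∀ m, ∑ n', Function.update x n y n' m = φ - x n m + y m := by
    intro m
    rw [← hload m, ← Finset.add_sum_erase _ _ (Finset.mem_univ n),
      ← Finset.add_sum_erase _ (fun n' => x n' m) (Finset.mem_univ n),
      Finset.sum_congr rfl (g := fun n' => x n' m) fun n' hn' => by
        rw [Function.update_of_ne (Finset.ne_of_mem_erase hn')]]
    simp only [Function.update_self]
    ring
  have hdiff : costV N a p (Function.update x n y) n - costV N a p x n =
      a * ∑ m, (y m - x n m) ^ 2 + a * (φ + c) * (∑ m, y m - ∑ m, x n m) := by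
    simp only [costV, hload, hload', hmarg, Function.update_self]
    rw [← Finset.sum_sub_distrib, ← Finset.sum_sub_distrib, Finset.mul_sum, Finset.mul_sum,
      ← Finset.sum_add_distrib]
    exact Finset.sum_congr rfl fun m _ => by ring
  have hsq : 0 ≤ a * ∑ m, (y m - x n m) ^ 2 := by positivity
  rw [hsum, sub_self, mul_zero, add_zero] at hdiff
  linarith

/-- A vector with one entry `y` and all other entries `z` sums to `y + (N - 1) * z`. -/
theorem sum_ite_eq_add_sub_one_mul {N : ℕ} (n : Fin N) (y z : ℝ) :
    ∑ m, (if m = n then y else z) = y + ((N : ℝ) - 1) * z := by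
  have h : ∀ m : Fin N, (if m = n then y else z) = (if m = n then y - z else 0) + z := by
    intro m
    split_ifs <;> ring
  rw [Finset.sum_congr rfl fun m _ => h m, Finset.sum_add_distrib]
  simp
  ring

/-- Proposition 2: `(ȳ, z̄, q̄)` with `q̄ = aφ(N+1)/(3N−1)`,
`z̄ = (φ/N)(2N−2)/(3N−1)`, `ȳ = (φ/N)(1 + (N−1)(N+1)/(3N−1))` is a symmetric equilibrium
of the hierarchical game with agreements: (i) when every CP charges `q̄`, the profile where
each subscriber sends `ȳ` to its associated CP and `z̄` to every other CP is a Nash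
equilibrium; (ii) no unilateral price deviation in `[0, p_max]` increases a CP's revenue. -/
theorem stmt9 (N : ℕ) (hN : 3 ≤ N) (φ a pmax : ℝ)
    (hφ : 0 < φ) (ha : 0 < a)
    (qbar zbar ybar : ℝ)
    (hqbar : qbar = a * φ * ((N : ℝ) + 1) / (3 * (N : ℝ) - 1))
    (hzbar : zbar = (φ / N) * ((2 * (N : ℝ) - 2) / (3 * (N : ℝ) - 1)))
    (hybar : ybar = (φ / N) * (1 + ((N : ℝ) - 1) * ((N : ℝ) + 1) / (3 * (N : ℝ) - 1)))
    (hpmax : a * φ * ((N : ℝ) + 1) / (3 * (N : ℝ) - 1) < pmax) :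
    IsNashV N φ a (fun _ => qbar) (fun n m => if m = n then ybar else zbar) ∧
    ∀ p : ℝ, 0 ≤ p → p ≤ pmax →
      p * ((N : ℝ) - 1) * uFlow N a φ p qbar ≤ qbar * ((N : ℝ) - 1) * zbar := by
  have hN' : (3 : ℝ) ≤ N := by exact_mod_cast hN
  have hN0 : (0 : ℝ) < N := by linarith
  have hD : (0 : ℝ) < 3 * (N : ℝ) - 1 := by linarith
  have hD' : (N : ℝ) * 3 - 1 ≠ 0 := by rw [mul_comm]; exact hD.ne'
  have hN1 : (0 : ℝ) < (N : ℝ) - 1 := by linarith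
  have hload : ybar + ((N : ℝ) - 1) * zbar = φ := by
    rw [hybar, hzbar]
    field_simp
    ring
  have hq : qbar = a * (ybar - zbar) := by
    rw [hqbar, hybar, hzbar]
    field_simp
    ring
  have hz : 0 ≤ zbar := by
    have : 0 ≤ 2 * (N : ℝ) - 2 := by linarith
    rw [hzbar]
    positivity
  have hy : 0 ≤ ybar := by
    rw [hybar]
    positivity
  have hrow : ∀ n : Fin N, ∑ m, (if m = n then ybar else zbar) = φ := fun n =>
    (sum_ite_eq_add_sub_one_mul n ybar zbar).trans hload
  refine ⟨⟨fun n => ⟨fun m => ?_, hrow n⟩, fun n y hfeas => ?_⟩, fun p _ _ => ?_⟩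
  · dsimp only
    split_ifs <;> assumption
  · refine costV_le_update_of_marginal_eq (φ := φ) (c := ybar) ha.le (fun m => ?_) (fun m => ?_)
      (hfeas.2.trans (hrow n).symm)
    · simpa only [eq_comm] using hrow m
    · split_ifs
      · ring
      · exact hq
  · have hgap : qbar * ((N : ℝ) - 1) * zbar - p * ((N : ℝ) - 1) * uFlow N a φ p qbar =
        ((N : ℝ) - 1) * (2 * ((N : ℝ) - 1) / (a * N * (N + 1))) * (p - qbar) ^ 2 := by
      rw [uFlow, hzbar, hqbar]
      field_simp
      ring
    have : 0 ≤ ((N : ℝ) - 1) * (2 * ((N : ℝ) - 1) / (a * N * (N + 1))) * (p - qbar) ^ 2 := by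
      positivity
    linarith
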